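/- Let G be a finite group. There exists a nontrivial normal subgroup of G that is a nonideal-kernel witness over ℝ if and only if one of the following holds: (i) G is abelian and nontrivial; (ii) G is generalized dicyclic; (iii) G ≅ C₄ × Q₈ × (C₂)^r for some r ≥ 0; (iv) G ≅ Q₈ × Q₈ × (C₂)^r for some r ≥ 0. -/

import Mathlib

open scoped BigOperators

/-- The averaging element `e_N = (1/|N|) ∑_{n ∈ N} n` in the group algebra `K[G]`. -/
noncomputable def aveIdem (K : Type*) [Field K] {G : Type*} [Group G] (N : Subgroup G) :
    MonoidAlgebra K G :=
  (Nat.card N : K)⁻¹ • ∑ᶠ n : N, MonoidAlgebra.of K G (n : G)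

/-- `N` is a nonideal-kernel witness over `K`: every nilpotent element `x` of `K[G]`
satisfies `x * e_N = x`. -/
def IsNKW (K : Type*) [Field K] {G : Type*} [Group G] (N : Subgroup G) : Prop :=
  ∀ x : MonoidAlgebra K G, IsNilpotent x → x * aveIdem K N = x

/-- `G` is generalized dicyclic: `G` is nonabelian, with an abelian subgroup `A` of index 2
and `g ∉ A` with `g² ≠ 1` and `g⁻¹ a g = a⁻¹` for all `a ∈ A`. -/
def IsGenDicyclic (G : Type*) [Group G] : Prop :=
  (¬ ∀ a b : G, a * b = b * a) ∧
  ∃ (A : Subgroup G) (g : G), (∀ a b : A, a * b = b * a) ∧ A.index = 2 ∧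
    g ∉ A ∧ g ^ 2 ≠ 1 ∧ ∀ a ∈ A, g⁻¹ * a * g = a⁻¹

theorem commutator_mul_eq_of_mul_self_eq_smul {R : Type*} [Ring R] [Algebra ℝ R] {e : R}
    (he : ∀ x : R, IsNilpotent x → x * e = x) {f : R} {s : ℝ} (hs : s ≠ 0)
    (hf : f * f = s • f) (g : R) : (f * g - g * f) * e = f * g - g * f := by
  have key : ∀ a b : R, a * b = 0 → b * g * a * e = b * g * a := fun a b h => by
    refine he _ ⟨2, ?_⟩
    calc (b * g * a) ^ 2 = b * g * (a * b) * g * a := by noncomm_ring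
      _ = 0 := by rw [h]; simp
  have h1 := key (s • 1 - f) f (by simp [sub_mul, hf])
  have h2 := key f (s • 1 - f) (by simp [mul_sub, hf])
  have h3 : s • (f * g - g * f) = f * g * (s • 1 - f) - (s • 1 - f) * g * f := by
    simp only [mul_sub, sub_mul, smul_mul_assoc, mul_smul_comm, mul_one, one_mul, smul_sub,
      mul_assoc]
    abel
  have h4 : s • ((f * g - g * f) * e) = s • (f * g - g * f) := by
    rw [← smul_mul_assoc, h3, sub_mul, h1, h2]
  exact smul_right_injective R hs h4

/-- Discrete Fourier analysis: in the image of the group algebra of a cyclic group, every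
`X i + X (-i)` is a real combination of scaled idempotents. -/
theorem add_neg_mem_span_quasiIdempotent {R : Type*} [Ring R] [Algebra ℝ R] {m : ℕ} [NeZero m]
    (X : AddChar (ZMod m) R) (i : ZMod m) :
    X i + X (-i) ∈ Submodule.span ℝ {f : R | ∃ s : ℝ, s ≠ 0 ∧ f * f = s • f} := by
  set C : ZMod m → ℝ := fun j => (ZMod.stdAddChar j : ℂ).re with hC
  have hCneg : ∀ j, C (-j) = C j := fun j => by
    simp [hC, AddChar.map_neg_eq_conj]
  have hCadd : ∀ a b, C (a + b) + C (a - b) = 2 * C a * C b := fun a b => by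
    simp only [hC, sub_eq_add_neg, AddChar.map_add_eq_mul, AddChar.map_neg_eq_conj, Complex.mul_re,
      Complex.conj_re, Complex.conj_im]
    ring
  have hCsum : ∀ j, ∑ k, C (k * j) = if j = 0 then (m : ℝ) else 0 := fun j => by
    have := congrArg Complex.re (AddChar.sum_mulShift j (ZMod.isPrimitive_stdAddChar m))
    rw [Complex.re_sum] at this
    rw [hC]
    simp only [this]
    split_ifs <;> simp
  set f : ZMod m → R := fun k => ∑ j, C (k * j) • X j with hf
  have hcf : ∀ j k, (X j + X (-j)) * f k = (2 * C (k * j)) • f k := fun j k => by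
    have h1 : X j * f k = ∑ l, C (k * l - k * j) • X l := by
      rw [hf, ← Equiv.sum_comp (Equiv.addRight j)]
      simp only [Finset.mul_sum, Equiv.coe_addRight, mul_smul_comm, ← AddChar.map_add_eq_mul]
      refine Finset.sum_congr rfl fun l _ => ?_
      rw [add_comm j l]
      congr 2
      ring
    have h2 : X (-j) * f k = ∑ l, C (k * l + k * j) • X l := by
      rw [hf, ← Equiv.sum_comp (Equiv.addRight (-j))]
      simp only [Finset.mul_sum, Equiv.coe_addRight, mul_smul_comm, ← AddChar.map_add_eq_mul]
      refine Finset.sum_congr rfl fun l _ => ?_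
      rw [add_comm (-j) l]
      congr 2
      ring
    rw [add_mul, h1, h2, ← Finset.sum_add_distrib, hf, Finset.smul_sum]
    refine Finset.sum_congr rfl fun l _ => ?_
    rw [← add_smul, smul_smul, add_comm (C _), hCadd]
    congr 1
    ring
  have hfc : ∀ k, (2 : ℝ) • f k = ∑ j, C (k * j) • (X j + X (-j)) := fun k => by
    simp only [smul_add, Finset.sum_add_distrib, two_smul]
    congr 1
    rw [hf, ← Equiv.sum_comp (Equiv.neg (ZMod m))]
    simp [hCneg]
  have hff : ∀ k, f k * f k = (∑ j, C (k * j) ^ 2) • f k := fun k => by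
    refine smul_right_injective R (two_ne_zero (α := ℝ)) ?_
    simp only
    rw [← smul_mul_assoc, hfc, Finset.sum_mul, Finset.sum_smul, Finset.smul_sum]
    refine Finset.sum_congr rfl fun j _ => ?_
    rw [smul_mul_assoc, hcf, smul_smul, smul_smul]
    congr 1
    ring
  have hs : ∀ k, ∑ j, C (k * j) ^ 2 ≠ 0 := fun k => by
    refine (Finset.sum_pos' (fun _ _ => sq_nonneg _) ⟨0, Finset.mem_univ _, ?_⟩).ne'
    simp [hC]
  have hsum : ∑ k, f k = (m : ℝ) • 1 := by
    rw [hf, Finset.sum_comm]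
    simp only [← Finset.sum_smul, hCsum, ite_smul, zero_smul, Finset.sum_ite_eq',
      Finset.mem_univ, if_true, AddChar.map_zero_eq_one]
  have hm : (m : ℝ) ≠ 0 := NeZero.ne _
  have hfin : X i + X (-i) = (m : ℝ)⁻¹ • ∑ k, (2 * C (k * i)) • f k := by
    simp only [← hcf]
    rw [← Finset.mul_sum, hsum, mul_smul_comm, mul_one, smul_smul, inv_mul_cancel₀ hm, one_smul]
  rw [hfin]
  exact Submodule.smul_mem _ _ <| Submodule.sum_mem _ fun k _ =>
    Submodule.smul_mem _ _ <| Submodule.subset_span ⟨_, hs k, hff k⟩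

theorem of_add_of_inv_mem_span_quasiIdempotent {G : Type*} [Group G] [Finite G] (x : G) :
    MonoidAlgebra.of ℝ G x + MonoidAlgebra.of ℝ G x⁻¹ ∈
      Submodule.span ℝ {f : MonoidAlgebra ℝ G | ∃ s : ℝ, s ≠ 0 ∧ f * f = s • f} := by
  have : NeZero (orderOf x) := ⟨(orderOf_pos x).ne'⟩
  let X : AddChar (ZMod (orderOf x)) (MonoidAlgebra ℝ G) :=
    { toFun := fun j => MonoidAlgebra.of ℝ G (x ^ j.val)
      map_zero_eq_one' := by rw [ZMod.val_zero, pow_zero, map_one]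
      map_add_eq_mul' := fun a b => by
        rw [ZMod.val_add, pow_mod_orderOf, pow_add, map_mul] }
  have h1 : X 1 = MonoidAlgebra.of ℝ G x := by
    change MonoidAlgebra.of ℝ G (x ^ (1 : ZMod (orderOf x)).val) = _
    rw [← Nat.cast_one, ZMod.val_natCast, pow_mod_orderOf, pow_one]
  have h2 : X (-1) = MonoidAlgebra.of ℝ G x⁻¹ := by
    have h : X (-1) * X 1 = 1 := by
      rw [← AddChar.map_add_eq_mul, neg_add_cancel, AddChar.map_zero_eq_one]
    calc X (-1) = X (-1) * (MonoidAlgebra.of ℝ G x * MonoidAlgebra.of ℝ G x⁻¹) := by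
          rw [← map_mul, mul_inv_cancel, map_one, mul_one]
      _ = _ := by rw [← mul_assoc, ← h1, h, one_mul]
  simpa only [h1, h2] using add_neg_mem_span_quasiIdempotent X 1

theorem aveIdem_mul_of {K G : Type*} [Field K] [Group G] [Finite G] {N : Subgroup G} {n : G}
    (hn : n ∈ N) : aveIdem K N * MonoidAlgebra.of K G n = aveIdem K N := by
  cases nonempty_fintype N
  rw [aveIdem, smul_mul_assoc, finsum_eq_sum_of_fintype, Finset.sum_mul]
  congr 1
  rw [← Equiv.sum_comp (Equiv.mulRight (⟨n, hn⟩ : N)) fun m : N => MonoidAlgebra.of K G (m : G)]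
  simp only [← map_mul, Equiv.coe_mulRight, Subgroup.coe_mul]

/-- If `N` is a nonideal-kernel witness, then every conjugate of `x` is `x` or `x⁻¹`, unless
`(x ^ 2)⁻¹` is the only nontrivial element of `N`. -/
theorem IsNKW.conj_eq {G : Type*} [Group G] [Finite G] {N : Subgroup G} (hN : IsNKW ℝ N)
    (x g : G) : g⁻¹ * x * g = x ∨ g⁻¹ * x * g = x⁻¹ ∨ ∀ n ∈ N, n ≠ 1 → n = (x ^ 2)⁻¹ := by
  classical
  by_cases h1 : g⁻¹ * x * g = x
  · exact .inl h1
  by_cases h2 : g⁻¹ * x * g = x⁻¹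
  · exact .inr (.inl h2)
  refine .inr (.inr fun n hn hn1 => ?_)
  have hc : ∀ c ∈ Submodule.span ℝ {f : MonoidAlgebra ℝ G | ∃ s : ℝ, s ≠ 0 ∧ f * f = s • f},
      (c * MonoidAlgebra.of ℝ G g - MonoidAlgebra.of ℝ G g * c) * aveIdem ℝ N =
        c * MonoidAlgebra.of ℝ G g - MonoidAlgebra.of ℝ G g * c := fun c hc => by
    induction hc using Submodule.span_induction with
    | mem f hf =>
      obtain ⟨s, hs, hf⟩ := hf
      exact commutator_mul_eq_of_mul_self_eq_smul hN hs hf _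
    | zero => simp
    | add a b _ _ ha hb =>
      have : (a + b) * MonoidAlgebra.of ℝ G g - MonoidAlgebra.of ℝ G g * (a + b) =
        (a * MonoidAlgebra.of ℝ G g - MonoidAlgebra.of ℝ G g * a) +
          (b * MonoidAlgebra.of ℝ G g - MonoidAlgebra.of ℝ G g * b) := by noncomm_ring
      rw [this, add_mul, ha, hb]
    | smul r a _ ha => rw [smul_mul_assoc, mul_smul_comm, ← smul_sub, smul_mul_assoc, ha]
  have hw := hc _ (of_add_of_inv_mem_span_quasiIdempotent x)
  set w := (MonoidAlgebra.of ℝ G x + MonoidAlgebra.of ℝ G x⁻¹) * MonoidAlgebra.of ℝ G g -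
    MonoidAlgebra.of ℝ G g * (MonoidAlgebra.of ℝ G x + MonoidAlgebra.of ℝ G x⁻¹) with hwdef
  have hwn : w * MonoidAlgebra.of ℝ G n = w := by
    rw [← hw, mul_assoc, aveIdem_mul_of hn]
  have hcoeff := congrArg (fun y => y.coeff (g * x * n)) hwn
  have h1' : ¬ x * g = g * x := fun h => h1 (by rw [mul_assoc, h, inv_mul_cancel_left])
  have h2' : ¬ x⁻¹ * g = g * x := fun h => h2 (by
    rw [← inv_inj, inv_inv]
    simp only [mul_inv_rev, inv_inv, ← mul_assoc]
    rw [mul_assoc, h, inv_mul_cancel_left])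
  by_contra hne
  have h3 : ¬ g * x⁻¹ = g * x * n := fun h => hne (by
    rw [mul_assoc, mul_right_inj] at h
    rw [pow_two, mul_inv_rev, eq_inv_mul_iff_mul_eq, h])
  have h4 : ¬ g * x = g * x * n := fun h => hn1 (by simpa using h)
  simp only [hwdef, MonoidAlgebra.of_apply, add_mul, mul_add, MonoidAlgebra.single_mul_single,
    mul_one, MonoidAlgebra.coeff_sub, MonoidAlgebra.coeff_add, Finsupp.sub_apply,
    Finsupp.add_apply, MonoidAlgebra.coeff_single, Finsupp.single_apply, sub_mul, mul_left_inj,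
    h1', h2', h3, h4, if_false, if_true] at hcoeff
  split_ifs at hcoeff <;> norm_num at hcoeff

/-- The linear map of the real group algebra inverting group elements. -/
noncomputable def MonoidAlgebra.invMap (G : Type*) [Group G] :
    MonoidAlgebra ℝ G →ₗ[ℝ] MonoidAlgebra ℝ G :=
  MonoidAlgebra.mapDomainLinearMap ℝ ℝ (·⁻¹)

namespace MonoidAlgebra
variable {G : Type*} [Group G]

theorem invMap_of (g : G) : invMap G (of ℝ G g) = of ℝ G g⁻¹ := by
  rw [of_apply, invMap, mapDomainLinearMap_single, of_apply]

theorem invMap_invMap (x : MonoidAlgebra ℝ G) : invMap G (invMap G x) = x := by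
  induction x using MonoidAlgebra.induction_on with
  | of g => rw [invMap_of, invMap_of, inv_inv]
  | add x y hx hy => simp [hx, hy]
  | smul r x hx => simp [hx]

theorem invMap_mul (x y : MonoidAlgebra ℝ G) : invMap G (x * y) = invMap G y * invMap G x := by
  induction x using MonoidAlgebra.induction_on with
  | of g =>
    induction y using MonoidAlgebra.induction_on with
    | of h => rw [← map_mul, invMap_of, invMap_of, invMap_of, mul_inv_rev, map_mul]
    | add x y hx hy => simp only [mul_add, add_mul, map_add, hx, hy]
    | smul r x hx => simp only [mul_smul_comm, smul_mul_assoc, map_smul, hx]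
  | add x y hx hy => simp only [mul_add, add_mul, map_add, hx, hy]
  | smul r x hx => simp only [mul_smul_comm, smul_mul_assoc, map_smul, hx]

theorem coeff_invMap (x : MonoidAlgebra ℝ G) (g : G) : (invMap G x).coeff g = x.coeff g⁻¹ := by
  induction x using MonoidAlgebra.induction_on with
  | of h =>
    classical
    rw [invMap_of]
    simp only [of_apply, coeff_single, Finsupp.single_apply, inv_eq_iff_eq_inv]
  | add x y hx hy => simp [hx, hy]
  | smul r x hx => simp [hx]

theorem eq_zero_of_invMap_mul_self {x : MonoidAlgebra ℝ G} (h : invMap G x * x = 0) : x = 0 := by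
  have h1 := congrArg (fun y => y.coeff 1) h
  simp only [coeff_mul_apply_right, coeff_invMap, one_mul, inv_inv, coeff_zero,
    Finsupp.coe_zero, Pi.zero_apply, Finsupp.sum] at h1
  rw [Finset.sum_eq_zero_iff_of_nonneg fun _ _ => mul_self_nonneg _] at h1
  ext g
  by_contra hg
  exact hg (mul_self_eq_zero.1 (h1 g (Finsupp.mem_support_iff.2 hg)))

/-- If the symmetrization of every group element is central in the component cut out by the central
idempotent `ε`, then that component contains no nonzero nilpotents. -/
theorem nilpotent_mul_eq_zero {ε : MonoidAlgebra ℝ G} (hε : ∀ y, Commute ε y) (hε2 : ε * ε = ε)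
    (hsymm : ∀ x g : G, Commute ((of ℝ G x + of ℝ G x⁻¹) * ε) (of ℝ G g))
    {u : MonoidAlgebra ℝ G} (hu : IsNilpotent u) : u * ε = 0 := by
  have hcent : ∀ w y : MonoidAlgebra ℝ G, Commute ((w + invMap G w) * ε) y := fun w y => by
    induction y using MonoidAlgebra.induction_on with
    | of g =>
      induction w using MonoidAlgebra.induction_on with
      | of x => simpa only [invMap_of] using hsymm x g
      | add a b ha hb =>
        have := ha.add_left hb
        rwa [← add_mul, add_add_add_comm, ← map_add] at this
      | smul r a ha =>
        have := ha.smul_left r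
        rwa [← smul_mul_assoc, smul_add, ← map_smul] at this
    | add a b ha hb => exact ha.add_right hb
    | smul r a ha => exact ha.smul_right r
  have hsq : ∀ v : MonoidAlgebra ℝ G, v * ε = v → v * v = 0 → v = 0 := fun v hv hvv => by
    have hw : ∀ y, Commute (v * invMap G v) y := fun y => by
      have h := hcent (v * invMap G v) y
      rw [invMap_mul, invMap_invMap, ← two_smul ℝ, smul_mul_assoc, mul_assoc, ← (hε _).eq,
        ← mul_assoc, hv] at h
      have := h.smul_left (2⁻¹ : ℝ)
      rwa [smul_smul, inv_mul_cancel₀ two_ne_zero, one_smul] at this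
    apply eq_zero_of_invMap_mul_self
    apply eq_zero_of_invMap_mul_self
    rw [invMap_mul, invMap_invMap]
    calc invMap G v * v * (invMap G v * v) = invMap G v * (v * invMap G v) * v := by
          simp only [mul_assoc]
      _ = v * (invMap G v * invMap G v) * v := by rw [← (hw _).eq]; simp only [mul_assoc]
      _ = 0 := by rw [← invMap_mul, hvv]; simp
  have hpow : ∀ k : ℕ, ∀ v : MonoidAlgebra ℝ G, v * ε = v → v ^ 2 ^ k = 0 → v = 0 := fun k => by
    induction k with
    | zero => intro v _ h; simpa using h
    | succ k ih =>
      intro v hv h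
      refine hsq v hv (ih _ (by rw [mul_assoc, hv]) ?_)
      rwa [← pow_two, ← pow_mul, ← pow_succ']
  obtain ⟨n, hn⟩ := hu
  refine hpow n _ (by rw [mul_assoc, hε2]) ?_
  rw [((hε u).symm).mul_pow, pow_eq_zero_of_le Nat.lt_two_pow_self.le hn, zero_mul]

end MonoidAlgebra

/-- `z` is an involution such that every element with square different from `z` is sent to itself
or to its inverse by each inner automorphism. -/
structure IsConjInvolution {G : Type*} [Group G] (z : G) : Prop where
  ne_one : z ≠ 1
  mul_self : z * z = 1
  conj_or : ∀ x g : G, x * g = g * x ∨ x * g = g * x⁻¹ ∨ x * x = z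

namespace IsConjInvolution
variable {G : Type*} [Group G] {z : G}

theorem commute_of_mul_self_eq_one (hz : IsConjInvolution z) {x : G} (hx : x * x = 1) (g : G) :
    Commute x g := by
  rcases hz.conj_or x g with h | h | h
  · exact h
  · rwa [← eq_inv_of_mul_eq_one_left hx] at h
  · exact absurd (h.symm.trans hx) hz.ne_one

theorem commute (hz : IsConjInvolution z) (g : G) : Commute z g :=
  hz.commute_of_mul_self_eq_one hz.mul_self g

theorem exists_isNKW (hz : IsConjInvolution z) :
    ∃ N : Subgroup G, N.Normal ∧ N ≠ ⊥ ∧ IsNKW ℝ N := by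
  have hzpow : z ^ 2 = 1 := by rw [pow_two, hz.mul_self]
  have hmem : ∀ x : G, x ∈ Subgroup.zpowers z ↔ x = 1 ∨ x = z := fun x => by
    constructor
    · rintro ⟨k, rfl⟩
      rcases Int.even_or_odd' k with ⟨l, rfl | rfl⟩
      · left; simp [zpow_mul, hzpow]
      · right; simp [zpow_add, zpow_mul, hzpow]
    · rintro (rfl | rfl)
      · exact one_mem _
      · exact Subgroup.mem_zpowers _
  have hord : orderOf z = 2 := orderOf_eq_prime hzpow hz.ne_one
  have he : aveIdem ℝ (Subgroup.zpowers z) =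
      (2⁻¹ : ℝ) • (1 + MonoidAlgebra.of ℝ G z) := by
    rw [aveIdem, Nat.card_zpowers, hord, Nat.cast_ofNat]
    congr 1
    have hset : ((Subgroup.zpowers z : Subgroup G) : Set G) = {1, z} := by
      ext x; simpa using hmem x
    have := finsum_set_coe_eq_finsum_mem (f := fun x : G => MonoidAlgebra.of ℝ G x)
      ((Subgroup.zpowers z : Subgroup G) : Set G)
    refine this.trans ?_
    rw [hset, finsum_mem_pair hz.ne_one.symm, map_one]
  have hzc : ∀ y, Commute (MonoidAlgebra.of ℝ G z) y := fun y => by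
    induction y using MonoidAlgebra.induction_on with
    | of g => exact (hz.commute g).map (MonoidAlgebra.of ℝ G)
    | add a b ha hb => exact ha.add_right hb
    | smul r a ha => exact ha.smul_right r
  have hzz : MonoidAlgebra.of ℝ G z * MonoidAlgebra.of ℝ G z = 1 := by
    rw [← map_mul, hz.mul_self, map_one]
  refine ⟨Subgroup.zpowers z, ⟨fun x hx g => ?_⟩, ?_, fun u hu => ?_⟩
  · rw [hmem] at hx ⊢
    rcases hx with hx | hx
    · simp [hx]
    · right
      rw [hx, ← (hz.commute g).eq, mul_inv_cancel_right]
  · rw [Ne, Subgroup.zpowers_eq_bot]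
    exact hz.ne_one
  · set ε : MonoidAlgebra ℝ G := (2⁻¹ : ℝ) • (1 - MonoidAlgebra.of ℝ G z) with hε
    have hε2 : ε * ε = ε := by
      rw [hε, smul_mul_smul_comm, sub_mul, mul_sub, mul_sub, hzz]
      simp only [one_mul, mul_one]
      rw [show (1 : MonoidAlgebra ℝ G) - MonoidAlgebra.of ℝ G z - (MonoidAlgebra.of ℝ G z - 1) =
        (2 : ℝ) • (1 - MonoidAlgebra.of ℝ G z) by rw [two_smul]; abel, smul_smul]
      norm_num
    have hεc : ∀ y, Commute ε y := fun y =>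
      ((Commute.one_left y).sub_left (hzc y)).smul_left _
    have h0 := MonoidAlgebra.nilpotent_mul_eq_zero hεc hε2 (fun x g => by
      have hconj : x * g = g * x ∨ x * g = g * x⁻¹ →
          Commute (MonoidAlgebra.of ℝ G x + MonoidAlgebra.of ℝ G x⁻¹)
            (MonoidAlgebra.of ℝ G g) := by
        rintro (h | h)
        · have h' : Commute x g := h
          exact (h'.map (MonoidAlgebra.of ℝ G)).add_left (h'.inv_left.map (MonoidAlgebra.of ℝ G))
        · have h' : x⁻¹ * g = g * x := by
            rw [inv_mul_eq_iff_eq_mul, ← mul_assoc, h, inv_mul_cancel_right]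
          rw [Commute, SemiconjBy, add_mul, mul_add]
          simp only [← map_mul]
          rw [h, h', add_comm]
      rcases hz.conj_or x g with h | h | h
      · exact (hconj (.inl h)).mul_left (hεc _)
      · exact (hconj (.inr h)).mul_left (hεc _)
      · have hx : x⁻¹ = x * z := by
          rw [inv_eq_iff_mul_eq_one, ← mul_assoc, h, hz.mul_self]
        have : (MonoidAlgebra.of ℝ G x + MonoidAlgebra.of ℝ G x⁻¹) * ε = 0 := by
          rw [hx, map_mul, ← mul_one_add, hε, mul_smul_comm, mul_assoc, add_mul, mul_sub, mul_sub,
            hzz]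
          simp
        rw [this]
        exact Commute.zero_left _) hu
    have hsum : aveIdem ℝ (Subgroup.zpowers z) = 1 - ε := by
      rw [he, hε, eq_sub_iff_add_eq, ← smul_add, show (1 : MonoidAlgebra ℝ G) +
        MonoidAlgebra.of ℝ G z + (1 - MonoidAlgebra.of ℝ G z) = (2 : ℝ) • 1 by
          rw [two_smul]; abel, smul_smul]
      norm_num
    rw [hsum, mul_sub, h0, mul_one, sub_zero]

theorem of_mulEquiv {H : Type*} [Group H] {w : H} (hw : IsConjInvolution w) (e : G ≃* H) :
    IsConjInvolution (e.symm w) where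
  ne_one h := hw.ne_one (by simpa using h)
  mul_self := by rw [← map_mul, hw.mul_self, map_one]
  conj_or x g := by
    rw [← e.injective.eq_iff (a := x * g) (b := g * x),
      ← e.injective.eq_iff (a := x * g) (b := g * x⁻¹), e.eq_symm_apply]
    simpa only [map_mul, map_inv] using hw.conj_or (e x) (e g)

theorem prod_one {E : Type*} [CommGroup E] (hE : ∀ x : E, x * x = 1) (hz : IsConjInvolution z) :
    IsConjInvolution ((z, 1) : G × E) where
  ne_one h := hz.ne_one (congrArg Prod.fst h)
  mul_self := by rw [Prod.mk_mul_mk, hz.mul_self, one_mul, Prod.mk_one_one]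
  conj_or := by
    rintro ⟨x, v⟩ ⟨g, w⟩
    have hv : v⁻¹ = v := inv_eq_of_mul_eq_one_left (hE v)
    simp only [Prod.mk_mul_mk, Prod.inv_mk, Prod.mk.injEq, hv, mul_comm v w, hE, and_true]
    exact hz.conj_or x g

end IsConjInvolution

theorem exists_isNKW_of_comm {G : Type*} [Group G] [Nontrivial G]
    (h : ∀ a b : G, a * b = b * a) : ∃ N : Subgroup G, N.Normal ∧ N ≠ ⊥ ∧ IsNKW ℝ N := by
  refine ⟨⊤, inferInstance, top_ne_bot, fun u hu => ?_⟩
  have := MonoidAlgebra.nilpotent_mul_eq_zero (ε := 1) (fun y => Commute.one_left y) (one_mul 1)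
    (fun x g => by
      have hx : Commute x g := h x g
      exact ((hx.map (MonoidAlgebra.of ℝ G)).add_left
        (hx.inv_left.map (MonoidAlgebra.of ℝ G))).mul_left (Commute.one_left _)) hu
  rw [mul_one] at this
  rw [this, zero_mul]

theorem exists_isConjInvolution {G : Type*} [Group G] [Finite G] {N : Subgroup G}
    (hN : N ≠ ⊥) (hNK : IsNKW ℝ N) (hG : ¬ ∀ a b : G, a * b = b * a) :
    ∃ z : G, IsConjInvolution z := by
  have hconj : ∀ x g y : G, g⁻¹ * x * g = y ↔ x * g = g * y := fun x g y => by
    rw [mul_assoc, inv_mul_eq_iff_eq_mul]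
  have hgood := hNK.conj_eq
  simp only [hconj] at hgood
  by_cases hall : ∀ x g : G, x * g = g * x ∨ x * g = g * x⁻¹
  · push Not at hG
    obtain ⟨x, y, hxy⟩ := hG
    have h1 : x * y = y * x⁻¹ := (hall x y).resolve_left hxy
    have h2 : y * x = x * y⁻¹ := (hall y x).resolve_left (Ne.symm hxy)
    have hsq : x * x = y * y := by
      have : y = x * (y * x) := by rw [← mul_assoc, h1, inv_mul_cancel_right]
      rw [h2, ← mul_assoc] at this
      exact (eq_mul_inv_iff_mul_eq.1 this).symm
    refine ⟨x * x, fun h => hxy ?_, ?_, fun a g => (hall a g).imp_right .inl⟩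
    · rw [h1, ← eq_inv_of_mul_eq_one_left h]
    · have h3 : x * x * y = y * (x * x)⁻¹ := by
        rw [mul_assoc, h1, ← mul_assoc, h1, mul_assoc, mul_inv_rev]
      have h4 : x * x * y = y * (x * x) := by rw [hsq, mul_assoc]
      exact mul_eq_one_iff_eq_inv.2 (mul_left_cancel (h4.symm.trans h3))
  · push Not at hall
    obtain ⟨x, g, h1, h2⟩ := hall
    have h3 := ((hgood x g).resolve_left h1).resolve_left h2
    obtain ⟨n, hn, hn1⟩ := N.bot_or_exists_ne_one.resolve_left hN
    have hinv : n⁻¹ = n :=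
      (h3 _ (inv_mem hn) (inv_ne_one.2 hn1)).trans (h3 _ hn hn1).symm
    refine ⟨n, hn1, mul_eq_one_iff_eq_inv.2 hinv.symm, fun a b => ?_⟩
    refine (hgood a b).imp_right (Or.imp_right fun h => ?_)
    rw [← pow_two, ← hinv, h _ hn hn1, inv_inv]

theorem IsGenDicyclic.exists_isConjInvolution {G : Type*} [Group G] (hG : IsGenDicyclic G) :
    ∃ z : G, IsConjInvolution z := by
  obtain ⟨-, A, g, hA, hidx, hg, hg2, hinv⟩ := hG
  have hgA : g * g ∈ A := Subgroup.mul_self_mem_of_index_two hidx g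
  have hconj : ∀ x ∈ A, x * g = g * x⁻¹ := fun x hx => by
    rw [← hinv x hx, ← mul_assoc, ← mul_assoc, mul_inv_cancel, one_mul]
  have hsplit : ∀ x, x ∉ A → ∃ a ∈ A, x = g * a := fun x hx =>
    ⟨g⁻¹ * x, (Subgroup.mul_mem_iff_of_index_two hidx).2 (by simp [hg, hx]), by simp⟩
  have hAc : ∀ a ∈ A, ∀ b ∈ A, a * b = b * a := fun a ha b hb =>
    congrArg Subtype.val (hA ⟨a, ha⟩ ⟨b, hb⟩)
  refine ⟨g * g, by rwa [← pow_two], ?_, fun x h => ?_⟩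
  · have := hconj _ hgA
    rw [mul_assoc] at this
    exact mul_eq_one_iff_eq_inv.2 (mul_left_cancel this)
  · by_cases hx : x ∈ A
    · by_cases hh : h ∈ A
      · exact .inl (hAc x hx h hh)
      · obtain ⟨a, ha, rfl⟩ := hsplit h hh
        right; left
        rw [← mul_assoc, hconj x hx, mul_assoc, hAc _ (inv_mem hx) _ ha, mul_assoc]
    · obtain ⟨a, ha, rfl⟩ := hsplit x hx
      right; right
      rw [mul_assoc, ← mul_assoc a, hconj a ha, mul_assoc, inv_mul_cancel, mul_one]

theorem quaternionGroup_two_conj_or (x g : QuaternionGroup 2) :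
    x * g = g * x ∨ x * g = g * x⁻¹ := by
  revert x g; decide

theorem quaternionGroup_two_mul_self (x : QuaternionGroup 2) :
    (x⁻¹ = x ∧ ∀ g, x * g = g * x) ∨ x * x = .a 2 := by
  revert x; decide

theorem zmod_four_mul_self (x : Multiplicative (ZMod 4)) :
    x⁻¹ = x ∨ x * x = .ofAdd 2 := by
  revert x; decide

theorem isConjInvolution_zmod_prod_quaternionGroup :
    IsConjInvolution ((.ofAdd 2, .a 2) : Multiplicative (ZMod 4) × QuaternionGroup 2) where
  ne_one := by decide
  mul_self := by decide
  conj_or := by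
    rintro ⟨x, y⟩ ⟨g, h⟩
    simp only [Prod.mk_mul_mk, Prod.inv_mk, Prod.mk.injEq]
    rcases zmod_four_mul_self x with hx | hx
    · rw [hx, mul_comm]
      simpa using (quaternionGroup_two_conj_or y h).imp_right .inl
    · rcases quaternionGroup_two_mul_self y with hy | hy
      · exact .inl ⟨mul_comm _ _, hy.2 h⟩
      · exact .inr (.inr ⟨hx, hy⟩)

theorem isConjInvolution_quaternionGroup_prod :
    IsConjInvolution ((.a 2, .a 2) : QuaternionGroup 2 × QuaternionGroup 2) where
  ne_one := by decide
  mul_self := by decide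
  conj_or := by
    rintro ⟨x, y⟩ ⟨g, h⟩
    simp only [Prod.mk_mul_mk, Prod.inv_mk, Prod.mk.injEq]
    rcases quaternionGroup_two_mul_self x with hx | hx
    · rw [hx.1, hx.2 g]
      simpa using (quaternionGroup_two_conj_or y h).imp_right .inl
    · rcases quaternionGroup_two_mul_self y with hy | hy
      · rw [hy.1, hy.2 h]
        simpa using (quaternionGroup_two_conj_or x g).imp_right .inl
      · exact .inr (.inr ⟨hx, hy⟩)

theorem exists_isConjInvolution_of_mulEquiv {G H₁ H₂ : Type*} [Group G] [Group H₁] [Group H₂]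
    {z : H₁ × H₂} (hz : IsConjInvolution z) {r : ℕ}
    (e : G ≃* H₁ × H₂ × (Fin r → Multiplicative (ZMod 2))) : ∃ w : G, IsConjInvolution w :=
  ⟨_, (hz.prod_one (E := Fin r → Multiplicative (ZMod 2)) fun x => funext fun i => by
    change x i * x i = 1
    generalize x i = y
    revert y; decide).of_mulEquiv (e.trans MulEquiv.prodAssoc.symm)⟩

/-- A sufficient condition for the centralizer of `a` to be the abelian subgroup of index two in a
generalized dicyclic group. -/
theorem isGenDicyclic_of_centralizer {G : Type*} [Group G] {a g : G} (hag : ¬ Commute a g)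
    (hg : g * g ≠ 1) (hidx : ∀ x, ¬ Commute a x → Commute a (x * g⁻¹))
    (hinv : ∀ b, Commute a b → b * g = g * b⁻¹) : IsGenDicyclic G := by
  have hmem : ∀ x, x ∈ Subgroup.centralizer {a} ↔ Commute a x := fun x => by
    rw [Subgroup.mem_centralizer_singleton_iff]
    exact ⟨fun h => h.symm, fun h => h.symm⟩
  refine ⟨fun h => hag (h a g), Subgroup.centralizer {a}, g, ?_, ?_, ?_, by rwa [pow_two], ?_⟩
  · rintro ⟨b, hb⟩ ⟨c, hc⟩
    rw [hmem] at hb hc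
    refine Subtype.ext (?_ : b * c = c * b)
    have h1 := hinv _ (hb.mul_right hc)
    rw [mul_assoc, hinv c hc, ← mul_assoc, hinv b hb, mul_assoc] at h1
    rw [← inv_inj, ← mul_left_cancel h1, mul_inv_rev]
  · rw [Subgroup.index_eq_two_iff]
    refine ⟨g⁻¹, fun b => ?_⟩
    rw [hmem, hmem]
    by_cases hb : Commute a b
    · refine .inr ⟨hb, fun h => hag ?_⟩
      simpa using ((hb.inv_right.mul_right h).inv_right)
    · exact .inl ⟨hidx b hb, hb⟩
  · rwa [hmem]
  · intro b hb
    rw [hmem] at hb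
    rw [mul_assoc, hinv b hb, inv_mul_cancel_left]

namespace IsConjInvolution
variable {G : Type*} [Group G] {z : G}

theorem mul_self_ne_one (hz : IsConjInvolution z) {a g : G} (hag : ¬ Commute a g) :
    g * g ≠ 1 := fun h => hag (hz.commute_of_mul_self_eq_one h a).symm

theorem commute_mul_inv_of_inverting {G : Type*} [Group G] {a x g : G} (hx : a * x = x * a⁻¹)
    (hg : a * g = g * a⁻¹) : Commute a (x * g⁻¹) := by
  have hx' : SemiconjBy x a⁻¹ a := hx.symm
  have hg' : SemiconjBy g a⁻¹ a := hg.symm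
  exact (hx'.mul_left hg'.inv_symm_left).symm

theorem isGenDicyclic_of_forall_mul_self (hz : IsConjInvolution z) {a b : G} (hab : ¬ Commute a b)
    (h : ∀ x y : G, ¬ Commute x y → x * x = z) : IsGenDicyclic G := by
  have hanti : ∀ x, ¬ Commute a x → a * x = x * a⁻¹ := fun x hx => by
    have h2 := h x a fun h => hx h.symm
    have h3 := h (a * x) a fun h => hx <| by
      simpa using ((Commute.refl a).inv_right.mul_right h.symm)
    rw [← h2, ← mul_assoc, mul_left_inj] at h3
    exact eq_mul_inv_of_mul_eq h3
  have ha2 := h a b hab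
  refine isGenDicyclic_of_centralizer hab (hz.mul_self_ne_one hab)
    (fun x hx => commute_mul_inv_of_inverting (hanti x hx) (hanti b hab)) (fun c hc => ?_)
  have hca : c * a * (c * a) = c * c * (a * a) := by
    rw [mul_assoc, ← mul_assoc a c a, hc.eq]; simp only [mul_assoc]
  by_cases hcc : ∀ y, Commute c y
  · have hc1 : c * c = 1 := by
      have h1 := h (c * a) b fun h => hab <| by
        simpa using ((hcc b).inv_left.mul_left h)
      rw [hca, ha2] at h1
      simpa using h1
    rw [← eq_inv_of_mul_eq_one_left hc1]
    exact hcc b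
  · push Not at hcc
    obtain ⟨y, hy⟩ := hcc
    have h1 : (c * a) * (c * a) = 1 := by rw [hca, h c y hy, ha2, hz.mul_self]
    have h2 : c * a * b = b * (c * a) := hz.commute_of_mul_self_eq_one h1 b
    have h3 : c⁻¹ = c * (a * a) := inv_eq_of_mul_eq_one_right (by rw [← mul_assoc, ← hca, h1])
    have h4 : c * a * b * a = c * b := by
      rw [mul_assoc c, hanti b hab, mul_assoc, inv_mul_cancel_right]
    rw [h3, ← h4, h2]
    simp only [mul_assoc]

theorem isGenDicyclic_or_exists_commute (hz : IsConjInvolution z) {a g : G}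
    (hag : ¬ Commute a g) (ha : a * a ≠ z) :
    IsGenDicyclic G ∨ ∃ c, Commute a c ∧ Commute c g ∧ c * c = a * a * z := by
  have hanti : ∀ x, ¬ Commute a x → a * x = x * a⁻¹ := fun x hx =>
    ((hz.conj_or a x).resolve_left hx).resolve_right ha
  by_cases hinv : ∀ b, Commute a b → b * g = g * b⁻¹
  · exact .inl (isGenDicyclic_of_centralizer hag (hz.mul_self_ne_one hag)
      (fun x hx => commute_mul_inv_of_inverting (hanti x hx) (hanti g hag)) hinv)
  right
  push Not at hinv
  obtain ⟨b, hab, hb⟩ := hinv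
  have hg := hanti g hag
  have hab2 : a * b * (a * b) = a * a * (b * b) := by
    rw [mul_assoc, ← mul_assoc b a b, ← hab.eq]; simp only [mul_assoc]
  have h1 : a * b * g ≠ g * (a * b)⁻¹ := fun h => hb <| by
    rw [mul_inv_rev, hab.eq, mul_assoc, hg, ← mul_assoc, ← mul_assoc, mul_left_inj] at h
    exact h
  rcases hz.conj_or b g with h | h | h
  · have hbg : Commute b g := h
    have h2 : ¬ Commute (a * b) g := fun h' => hag <| by
      simpa using h'.mul_left hbg.inv_left
    have h3 := ((hz.conj_or (a * b) g).resolve_left h2).resolve_left h1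
    rw [hab2] at h3
    have haa : a * a = z * (b * b)⁻¹ := eq_mul_inv_of_mul_eq h3
    have hag2 : Commute (a * a) g := by
      rw [haa]
      exact (hz.commute g).mul_left (hbg.mul_left hbg).inv_left
    refine ⟨b, hab, hbg, ?_⟩
    have h4 : a * a * g = g * (a⁻¹ * a⁻¹) := by
      rw [mul_assoc, hg, ← mul_assoc, hg, mul_assoc]
    have h5 : a * a = a⁻¹ * a⁻¹ := mul_left_cancel (hag2.eq.symm.trans h4)
    rw [h5, ← mul_inv_rev, ← h3, inv_mul_cancel_left]
  · exact absurd h hb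
  · have h2 : a * b * (a * b) ≠ z := fun h' => hag <| by
      rw [hab2, h] at h'
      exact hz.commute_of_mul_self_eq_one (by simpa using h') g
    refine ⟨a * b, (Commute.refl a).mul_right hab, ?_, by rw [hab2, h]⟩
    exact ((hz.conj_or (a * b) g).resolve_right fun h' => h'.elim h1 h2)

theorem exists_quaternion_generator (hz : IsConjInvolution z) {a g c : G} (hag : ¬ Commute a g)
    (ha : a * a ≠ z) (hac : Commute a c) (hcg : Commute c g) (hc : c * c = a * a * z) :
    ∃ b, a * b = b * a⁻¹ ∧ b * b = a * a ∧ Commute c b := by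
  have hg := ((hz.conj_or a g).resolve_left hag).resolve_right ha
  by_cases hgz : g * g = z
  · refine ⟨c * g, ?_, ?_, (Commute.refl c).mul_right hcg⟩
    · rw [← mul_assoc, hac.eq, mul_assoc, hg, mul_assoc]
    · rw [mul_assoc, ← mul_assoc g c g, ← hcg.eq, mul_assoc c, ← mul_assoc, hc, hgz, mul_assoc,
        hz.mul_self, mul_one]
  · refine ⟨g, hg, ?_, hcg⟩
    have hga := ((hz.conj_or g a).resolve_left fun h => hag h.symm).resolve_right hgz
    have h1 : g = a * (g * a) := by rw [← mul_assoc, hg, inv_mul_cancel_right]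
    rw [hga, ← mul_assoc] at h1
    exact eq_mul_inv_iff_mul_eq.1 h1

end IsConjInvolution

/-- The homomorphism from the cyclic group of order `n` sending the generator to `x`. -/
def zmodPowHom {M : Type*} [Monoid M] {n : ℕ} [NeZero n] (x : M) (hx : x ^ n = 1) :
    Multiplicative (ZMod n) →* M where
  toFun j := x ^ (Multiplicative.toAdd j).val
  map_one' := by simp
  map_mul' i j := by rw [toAdd_mul, ZMod.val_add, ← pow_eq_pow_mod _ hx, pow_add]

theorem zmodPowHom_ofAdd_natCast {M : Type*} [Monoid M] {n : ℕ} [NeZero n] (x : M)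
    (hx : x ^ n = 1) (k : ℕ) : zmodPowHom x hx (.ofAdd (k : ZMod n)) = x ^ k := by
  change x ^ (k : ZMod n).val = x ^ k
  rw [ZMod.val_natCast, ← pow_eq_pow_mod _ hx]

/-- The homomorphism from the quaternion group of order `4 * n` given by its presentation. -/
def QuaternionGroup.lift {G : Type*} [Group G] {n : ℕ} [NeZero n] (x y : G)
    (hx : x ^ (2 * n) = 1) (hy : y * y = x ^ n) (hxy : x * y = y * x⁻¹) :
    QuaternionGroup n →* G where
  toFun
    | .a i => zmodPowHom x hx (.ofAdd i)
    | .xa i => y * zmodPowHom x hx (.ofAdd i)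
  map_one' := map_one (zmodPowHom x hx)
  map_mul' := by
    have hsemi : ∀ i, zmodPowHom x hx i * y = y * (zmodPowHom x hx i)⁻¹ := fun i => by
      have h : SemiconjBy y x⁻¹ x := hxy.symm
      have := h.pow_right (Multiplicative.toAdd i).val
      rw [inv_pow] at this
      exact this.symm
    have hn : zmodPowHom x hx (.ofAdd (n : ZMod (2 * n))) = y * y := by
      rw [zmodPowHom_ofAdd_natCast, hy]
    rintro (i | i) (j | j)
    · simp [ofAdd_add]
    · simp only [QuaternionGroup.a_mul_xa, ofAdd_sub, div_eq_mul_inv, map_mul, map_inv]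
      rw [← mul_assoc (zmodPowHom x hx _) y, hsemi, mul_assoc, ← map_inv, ← map_mul,
        ← map_mul, mul_comm (Multiplicative.ofAdd j)]
    · simp [ofAdd_add, mul_assoc]
    · simp only [QuaternionGroup.xa_mul_xa, ofAdd_sub, ofAdd_add, div_eq_mul_inv, map_mul, map_inv,
        hn]
      rw [mul_assoc y (zmodPowHom x hx _), ← mul_assoc _ y, hsemi]
      simp only [mul_assoc]
      rw [← map_inv, ← map_mul, ← map_mul, mul_comm (Multiplicative.ofAdd j)]

theorem zmodPowHom_commute {M : Type*} [Monoid M] {n : ℕ} [NeZero n] {x y : M}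
    {hx : x ^ n = 1} (h : Commute x y) (i) : Commute (zmodPowHom x hx i) y :=
  h.pow_left _

namespace QuaternionGroup
variable {G : Type*} [Group G] {n : ℕ} [NeZero n] {x y : G} {hx : x ^ (2 * n) = 1}
    {hy : y * y = x ^ n} {hxy : x * y = y * x⁻¹}

theorem lift_commute {c : G} (h : Commute x c) (h' : Commute y c) (q) :
    Commute (lift x y hx hy hxy q) c := by
  rcases q with i | i
  · exact zmodPowHom_commute (hx := hx) h _
  · exact h'.mul_left (zmodPowHom_commute (hx := hx) h _)

theorem lift_a_natCast (k : ℕ) : lift x y hx hy hxy (a k) = x ^ k :=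
  zmodPowHom_ofAdd_natCast x hx k

theorem lift_xa_natCast (k : ℕ) : lift x y hx hy hxy (xa k) = y * x ^ k :=
  congrArg (y * ·) (zmodPowHom_ofAdd_natCast x hx k)

end QuaternionGroup

/-- A finite group that is the product of a subgroup `P` and a set of central involutions splits
off an elementary abelian complement to `P`. -/
theorem exists_mulEquiv_prod_elementary {G P : Type*} [Group G] [Finite G] [Group P]
    (f : P →* G) (hf : Function.Injective f)
    (hcent : ∀ w g : G, w * w = 1 → Commute w g)
    (hsurj : ∀ x : G, ∃ p w, w * w = 1 ∧ x = f p * w) :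
    ∃ r : ℕ, Nonempty (G ≃* P × (Fin r → Multiplicative (ZMod 2))) := by
  have hstep : ∀ k r : ℕ, Nat.card G ≤ k + r →
      ∀ F : P × (Fin r → Multiplicative (ZMod 2)) →* G, Function.Injective F →
      (∀ p, F (p, 1) = f p) →
      ∃ r : ℕ, Nonempty (G ≃* P × (Fin r → Multiplicative (ZMod 2))) := by
    intro k
    induction k with
    | zero =>
      intro r hr F hF _
      exfalso
      have hinj : Function.Injective fun v => F (1, v) := fun v w h => by
        simpa using hF h
      have h1 := Nat.card_le_card_of_injective _ hinj
      have h2 : r < 2 ^ r := Nat.lt_two_pow_self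
      simp at h1
      omega
    | succ k ih =>
      intro r hr F hF hFf
      by_cases hs : Function.Surjective F
      · exact ⟨r, ⟨(MulEquiv.ofBijective F ⟨hF, hs⟩).symm⟩⟩
      · rw [Function.Surjective] at hs
        push Not at hs
        obtain ⟨x, hx⟩ := hs
        obtain ⟨p, w, hw, rfl⟩ := hsurj x
        have hwF : ∀ q, F q ≠ w := fun q hq => hx ((p, 1) * q) (by rw [map_mul, hFf, hq])
        have hw2 : w ^ 2 = 1 := by rw [pow_two, hw]
        let W := zmodPowHom w hw2
        let F₁ : P × (Fin (r + 1) → Multiplicative (ZMod 2)) →* G :=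
          { toFun := fun q => F (q.1, Fin.tail q.2) * W (q.2 0)
            map_one' := by
              simp only [Prod.fst_one, Prod.snd_one, Pi.one_apply, map_one, mul_one]
              exact map_one F
            map_mul' := fun a b => by
              have h1 : F ((a * b).1, Fin.tail (a * b).2) =
                  F (a.1, Fin.tail a.2) * F (b.1, Fin.tail b.2) :=
                map_mul F (a.1, Fin.tail a.2) (b.1, Fin.tail b.2)
              have h2 : W ((a * b).2 0) = W (a.2 0) * W (b.2 0) := map_mul W _ _
              have h3 : Commute (W (a.2 0)) (F (b.1, Fin.tail b.2)) :=
                zmodPowHom_commute (hcent w _ hw) _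
              rw [h1, h2, h3.mul_mul_mul_comm] }
        refine ih (r + 1) (by omega) F₁ ((injective_iff_map_eq_one F₁).2 ?_) fun q => ?_
        · rintro ⟨q, v⟩ hqv
          have h : F (q, Fin.tail v) * w ^ (Multiplicative.toAdd (v 0)).val = 1 := hqv
          have h0 : v 0 = 1 ∨ v 0 = .ofAdd 1 := by
            generalize v 0 = u
            revert u; decide
          rcases h0 with h0 | h0
          · rw [h0, toAdd_one, ZMod.val_zero, pow_zero, mul_one] at h
            have h' := (injective_iff_map_eq_one F).1 hF _ h
            rw [Prod.mk_eq_one] at h' ⊢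
            refine ⟨h'.1, funext fun i => ?_⟩
            refine Fin.cases h0 (fun j => congrFun h'.2 j) i
          · rw [h0, toAdd_ofAdd, ZMod.val_one, pow_one] at h
            refine absurd (eq_inv_of_mul_eq_one_left h) ?_
            rw [← eq_inv_of_mul_eq_one_left hw]
            exact hwF _
        · change F (q, 1) * W 1 = f q
          rw [map_one, mul_one]
          exact hFf q
  refine hstep (Nat.card G) 0 le_rfl (f.comp (MonoidHom.fst _ _)) ?_ fun _ => rfl
  rintro ⟨p, v⟩ ⟨q, w⟩ h
  exact Prod.ext (hf h) (Subsingleton.elim _ _)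

namespace IsConjInvolution
variable {G : Type*} [Group G] {z a b : G}

theorem mul_self_mul_mul_self_of_quaternion (hab : a * b = b * a⁻¹) (hba : b * b = a * a) :
    a * a * (a * a) = 1 := by
  have h1 : a * a * b = b * (a⁻¹ * a⁻¹) := by
    rw [mul_assoc, hab, ← mul_assoc, hab, mul_assoc]
  have h2 : a * a * b = b * (a * a) := by rw [← hba, mul_assoc]
  rw [h2, ← mul_inv_rev] at h1
  exact mul_eq_one_iff_eq_inv.2 (mul_left_cancel h1)

theorem mul_self_of_commute_quaternion (hz : IsConjInvolution z) (hab : a * b = b * a⁻¹)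
    (hba : b * b = a * a) (ha1 : a * a ≠ 1) {y : G} (hay : Commute a y)
    (hby : Commute b y) : y * y = 1 ∨ y * y = a * a * z := by
  rcases hz.conj_or (a * y) b with h | h | h
  · refine absurd ?_ ha1
    rw [mul_assoc, ← hby.eq, ← mul_assoc, ← mul_assoc, mul_left_inj, hab, mul_right_inj] at h
    exact (mul_eq_one_iff_eq_inv.2 h.symm)
  · rw [mul_assoc, ← hby.eq, ← mul_assoc, hab, hay.eq, mul_inv_rev, mul_assoc, mul_right_inj,
      mul_right_inj] at h
    exact .inl (mul_eq_one_iff_eq_inv.2 h)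
  · rw [mul_assoc, ← mul_assoc y a y, ← hay.eq, mul_assoc, ← mul_assoc] at h
    refine .inr ?_
    rw [← h, ← mul_assoc, mul_self_mul_mul_self_of_quaternion hab hba, one_mul]

theorem exists_eq_quaternion_mul (hz : IsConjInvolution z) (h4 : a ^ (2 * 2) = 1)
    (hba : b * b = a ^ 2) (hab : a * b = b * a⁻¹) (ha : a * a ≠ z) (x : G) :
    ∃ q y, Commute a y ∧ Commute b y ∧ x = QuaternionGroup.lift a b h4 hba hab q * y := by
  have key : ∀ q, Commute a (x * (QuaternionGroup.lift a b h4 hba hab q)⁻¹) →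
      Commute b (x * (QuaternionGroup.lift a b h4 hba hab q)⁻¹) →
      ∃ q y, Commute a y ∧ Commute b y ∧ x = QuaternionGroup.lift a b h4 hba hab q * y :=
    fun q h1 h2 => ⟨q, _, h1, h2, by
      rw [(QuaternionGroup.lift_commute h1 h2 q).eq, inv_mul_cancel_right]⟩
  have hψa : QuaternionGroup.lift a b h4 hba hab (.a 1) = a := by
    simpa using QuaternionGroup.lift_a_natCast (hx := h4) (hy := hba) (hxy := hab) 1
  have hψb : QuaternionGroup.lift a b h4 hba hab (.xa 0) = b := by
    simpa using QuaternionGroup.lift_xa_natCast (hx := h4) (hy := hba) (hxy := hab) 0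
  rw [pow_two] at hba
  have hba' : b * a = a * b⁻¹ := by
    rw [eq_mul_inv_iff_mul_eq, mul_assoc, hab, ← mul_assoc, hba, mul_inv_cancel_right]
  rcases hz.conj_or a x with hax | hax | h
  · rcases hz.conj_or b x with hbx | hbx | h
    · exact key 1 (by rwa [map_one, inv_one, mul_one]) (by rwa [map_one, inv_one, mul_one])
    · refine key (.a 1) ?_ ?_ <;> rw [hψa]
      · exact Commute.mul_right hax (Commute.refl a).inv_right
      · exact commute_mul_inv_of_inverting hbx hba'
    · exact absurd (hba.symm.trans h) ha
  · rcases hz.conj_or b x with hbx | hbx | h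
    · refine key (.xa 0) ?_ ?_ <;> rw [hψb]
      · exact commute_mul_inv_of_inverting hax hab
      · exact Commute.mul_right hbx (Commute.refl b).inv_right
    · refine key (.a 1 * .xa 0) ?_ ?_ <;> rw [map_mul, hψa, hψb]
      · exact commute_mul_inv_of_inverting hax (by rw [hab, ← mul_assoc, hab])
      · refine commute_mul_inv_of_inverting hbx ?_
        rw [← mul_assoc, hba']
        simp
    · exact absurd (hba.symm.trans h) ha
  · exact absurd h ha

theorem exists_mulEquiv_prod_quaternionGroup [Finite G] {H : Type*} [Group H]
    (hz : IsConjInvolution z) (h4 : a ^ (2 * 2) = 1) (hba : b * b = a ^ 2) (hab : a * b = b * a⁻¹)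
    (ha : a * a ≠ z) (ha1 : a * a ≠ 1) (φ : H →* G) (haφ : ∀ h, Commute a (φ h))
    (hbφ : ∀ h, Commute b (φ h)) {s : H} (hs : φ s = a * a * z)
    (hH : ∀ h : H, h = 1 ∨ h = s ∨ h * h = s)
    (hφ : ∀ y, Commute a y → Commute b y → ∃ h w, w * w = 1 ∧ y = φ h * w) :
    ∃ r : ℕ, Nonempty (G ≃* H × QuaternionGroup 2 × (Fin r → Multiplicative (ZMod 2))) := by
  have hcomm : ∀ h q, Commute (φ h) (QuaternionGroup.lift a b h4 hba hab q) := fun h q =>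
    (QuaternionGroup.lift_commute (haφ h) (hbφ h) q).symm
  have hψ : QuaternionGroup.lift a b h4 hba hab (.a 2) = a * a := by
    simpa [pow_two] using QuaternionGroup.lift_a_natCast (hx := h4) (hy := hba) (hxy := hab) 2
  let f := φ.noncommCoprod (QuaternionGroup.lift a b h4 hba hab) hcomm
  have hf : ∀ h q, f (h, q) = φ h * QuaternionGroup.lift a b h4 hba hab q := fun _ _ => rfl
  have hQ : ∀ q : QuaternionGroup 2, q = 1 ∨ q = .a 2 ∨ q * q = .a 2 := by decide
  have hc : Commute (a * a) z := (hz.commute _).symm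
  have haa : a * a * (a * a) = 1 := by rw [← pow_two, ← pow_two, ← pow_mul, h4]
  have hs1 : a * a * z ≠ 1 := fun h => ha <| by
    rw [eq_inv_of_mul_eq_one_left h, ← eq_inv_of_mul_eq_one_left hz.mul_self]
  have hss : φ (s * s) = 1 := by
    rw [map_mul, hs, hc.symm.mul_mul_mul_comm, haa, hz.mul_self, one_mul]
  have hinj : Function.Injective f := (injective_iff_map_eq_one f).2 <| by
    rintro ⟨h, q⟩ hhq
    have h2 : f (h * h, q * q) = 1 := by rw [← Prod.mk_mul_mk, map_mul, hhq, one_mul]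
    rw [hf] at hhq h2
    rcases hH h with rfl | rfl | hh <;> rcases hQ q with rfl | rfl | hq
    · rfl
    · exact absurd (by simpa [hψ] using hhq) ha1
    · exact absurd (by simpa [hq, hψ] using h2) ha1
    · exact absurd (by simpa [hs] using hhq) hs1
    · rw [hs, hψ, mul_assoc, ← hc.eq, ← mul_assoc, haa, one_mul] at hhq
      exact absurd hhq hz.ne_one
    · exact absurd (by simpa only [hss, hq, hψ, one_mul] using h2) ha1
    · exact absurd (by simpa [hh, hs] using h2) hs1
    · rw [show (.a 2 * .a 2 : QuaternionGroup 2) = 1 by decide, map_one, mul_one, hh, hs] at h2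
      exact absurd h2 hs1
    · rw [hh, hq, hs, hψ, mul_assoc, ← hc.eq, ← mul_assoc, haa, one_mul] at h2
      exact absurd h2 hz.ne_one
  obtain ⟨r, ⟨e⟩⟩ := exists_mulEquiv_prod_elementary f hinj
    (fun w g hw => hz.commute_of_mul_self_eq_one hw g) fun x => by
      obtain ⟨q, y, hay, hby, rfl⟩ := hz.exists_eq_quaternion_mul h4 hba hab ha x
      obtain ⟨h, w, hw, rfl⟩ := hφ y hay hby
      exact ⟨(h, q), w, hw, by rw [hf, (hcomm h q).eq, mul_assoc]⟩
  exact ⟨r, ⟨e.trans MulEquiv.prodAssoc⟩⟩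

theorem exists_mulEquiv_of_quaternion [Finite G] {c : G} (hz : IsConjInvolution z)
    (hab : a * b = b * a⁻¹) (hba : b * b = a * a) (ha : a * a ≠ z) (ha1 : a * a ≠ 1)
    (hac : Commute a c) (hbc : Commute b c) (hc : c * c = a * a * z) :
    (∃ r : ℕ, Nonempty (G ≃* Multiplicative (ZMod 4) × QuaternionGroup 2 ×
      (Fin r → Multiplicative (ZMod 2)))) ∨
    ∃ r : ℕ, Nonempty (G ≃* QuaternionGroup 2 × QuaternionGroup 2 ×
      (Fin r → Multiplicative (ZMod 2))) := by
  have haa := mul_self_mul_mul_self_of_quaternion hab hba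
  have ha4 : a ^ (2 * 2) = 1 := by rw [pow_mul, pow_two, pow_two, haa]
  have hba2 : b * b = a ^ 2 := by rw [hba, pow_two]
  have hs1 : c * c ≠ 1 := fun h => ha <| by
    rw [hc] at h
    rw [eq_inv_of_mul_eq_one_left h, ← eq_inv_of_mul_eq_one_left hz.mul_self]
  have hss : c * c * (c * c) = 1 := by
    rw [hc, (hz.commute (a * a)).mul_mul_mul_comm, haa, hz.mul_self, one_mul]
  have hc4 : c ^ (2 * 2) = 1 := by rw [pow_mul, pow_two, pow_two, hss]
  have hsq : ∀ y, Commute a y → Commute b y → y * y ≠ 1 → y * y = c * c := fun y h1 h2 h3 =>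
    ((hz.mul_self_of_commute_quaternion hab hba ha1 h1 h2).resolve_left h3).trans hc.symm
  have hanti : ∀ x y, y * y = c * c → x * y * (x * y) = c * c → x * y = y * x⁻¹ :=
    fun x y h1 h2 => by
      rw [← h1, ← mul_assoc, mul_left_inj] at h2
      exact eq_mul_inv_of_mul_eq h2
  have hrep : ∀ {H : Type} [Group H] (φ : H →* G) (h : H) {u y : G}, φ h = u →
      u * y * (u * y) = 1 → ∃ h w, w * w = 1 ∧ y = φ h * w := fun φ h u y hu hy =>
    ⟨h⁻¹, u * y, hy, by rw [map_inv, hu, inv_mul_cancel_left]⟩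
  by_cases hd : ∃ d, Commute a d ∧ Commute b d ∧ d * d ≠ 1 ∧ c * d * (c * d) ≠ 1
  · obtain ⟨d, had, hbd, hd1, hcd1⟩ := hd
    right
    have hdc := hsq d had hbd hd1
    have hcd := hanti c d hdc (hsq _ (hac.mul_right had) (hbc.mul_right hbd) hcd1)
    have hdc2 : d * d = c ^ 2 := by rw [hdc, pow_two]
    refine hz.exists_mulEquiv_prod_quaternionGroup ha4 hba2 hab ha ha1
      (QuaternionGroup.lift c d hc4 hdc2 hcd) (s := .a 2)
      (fun h => (QuaternionGroup.lift_commute hac.symm had.symm h).symm)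
      (fun h => (QuaternionGroup.lift_commute hbc.symm hbd.symm h).symm) ?_ (by decide)
      fun y hay hby => ?_
    · rw [← hc]
      simpa [pow_two] using
        QuaternionGroup.lift_a_natCast (hx := hc4) (hy := hdc2) (hxy := hcd) 2
    have hφc : QuaternionGroup.lift c d hc4 hdc2 hcd (.a 1) = c := by
      simpa using QuaternionGroup.lift_a_natCast (hx := hc4) (hy := hdc2) (hxy := hcd) 1
    have hφd : QuaternionGroup.lift c d hc4 hdc2 hcd (.xa 0) = d := by
      simpa using QuaternionGroup.lift_xa_natCast (hx := hc4) (hy := hdc2) (hxy := hcd) 0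
    by_cases h1 : y * y = 1
    · exact ⟨1, y, h1, by rw [map_one, one_mul]⟩
    by_cases h2 : c * y * (c * y) = 1
    · exact hrep _ _ hφc h2
    by_cases h3 : d * y * (d * y) = 1
    · exact hrep _ _ hφd h3
    by_cases h4 : c * d * y * (c * d * y) = 1
    · exact hrep _ (.a 1 * .xa 0) (by rw [map_mul, hφc, hφd]) h4
    have h1 := hsq y hay hby h1
    have h2 := hanti c y h1 (hsq _ (hac.mul_right hay) (hbc.mul_right hby) h2)
    have h3 := hanti d y h1 (hsq _ (had.mul_right hay) (hbd.mul_right hby) h3)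
    have h4 := hanti (c * d) y h1
      (hsq _ ((hac.mul_right had).mul_right hay) ((hbc.mul_right hbd).mul_right hby) h4)
    refine absurd ?_ hs1
    have h5 : c * d * y = y * (c⁻¹ * d⁻¹) := by rw [mul_assoc, h3, ← mul_assoc, h2, mul_assoc]
    rw [h5, ← mul_inv_rev, mul_right_inj, inv_inj, hcd, mul_right_inj] at h4
    exact mul_eq_one_iff_eq_inv.2 h4
  · push Not at hd
    left
    refine hz.exists_mulEquiv_prod_quaternionGroup ha4 hba2 hab ha ha1
      (zmodPowHom (n := 4) c hc4) (s := .ofAdd 2) (fun h => (zmodPowHom_commute hac.symm h).symm)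
      (fun h => (zmodPowHom_commute hbc.symm h).symm) ?_ (by decide) fun y hay hby => ?_
    · rw [← hc, ← pow_two]
      exact zmodPowHom_ofAdd_natCast (n := 4) c hc4 2
    by_cases h1 : y * y = 1
    · exact ⟨1, y, h1, by rw [map_one, one_mul]⟩
    · refine hrep _ (.ofAdd 1) ?_ (hd y hay hby h1)
      simpa using zmodPowHom_ofAdd_natCast (n := 4) c hc4 1

end IsConjInvolution

theorem stmt1 (G : Type*) [Group G] [Finite G] :
    (∃ N : Subgroup G, N.Normal ∧ N ≠ ⊥ ∧ IsNKW ℝ N) ↔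
      (((∀ a b : G, a * b = b * a) ∧ Nontrivial G) ∨
       IsGenDicyclic G ∨
       (∃ r : ℕ, Nonempty
         (G ≃* Multiplicative (ZMod 4) × QuaternionGroup 2 ×
            (Fin r → Multiplicative (ZMod 2)))) ∨
       (∃ r : ℕ, Nonempty
         (G ≃* QuaternionGroup 2 × QuaternionGroup 2 ×
            (Fin r → Multiplicative (ZMod 2))))) := by
  constructor
  · rintro ⟨N, -, hN, hNK⟩
    by_cases hG : ∀ a b : G, a * b = b * a
    · obtain ⟨n, hn⟩ := Subgroup.ne_bot_iff_exists_ne_one.1 hN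
      exact .inl ⟨hG, n, 1, fun h => hn (Subtype.ext h)⟩
    right
    obtain ⟨z, hz⟩ := exists_isConjInvolution hN hNK hG
    push Not at hG
    obtain ⟨x, y, hxy⟩ := hG
    by_cases h : ∀ x y : G, ¬ Commute x y → x * x = z
    · exact .inl (hz.isGenDicyclic_of_forall_mul_self hxy h)
    push Not at h
    obtain ⟨a, g, hag, ha⟩ := h
    refine (hz.isGenDicyclic_or_exists_commute hag ha).imp_right ?_
    rintro ⟨c, hac, hcg, hc⟩
    obtain ⟨b, hab, hba, hcb⟩ := hz.exists_quaternion_generator hag ha hac hcg hc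
    exact hz.exists_mulEquiv_of_quaternion hab hba ha
      (fun h => hag (hz.commute_of_mul_self_eq_one h g)) hac hcb.symm hc
  · rintro (⟨hG, _⟩ | hG | ⟨r, ⟨e⟩⟩ | ⟨r, ⟨e⟩⟩)
    · exact exists_isNKW_of_comm hG
    · obtain ⟨z, hz⟩ := hG.exists_isConjInvolution
      exact hz.exists_isNKW
    · obtain ⟨z, hz⟩ :=
        exists_isConjInvolution_of_mulEquiv isConjInvolution_zmod_prod_quaternionGroup e
      exact hz.exists_isNKW
    · obtain ⟨z, hz⟩ := exists_isConjInvolution_of_mulEquiv isConjInvolution_quaternionGroup_prod e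
      exact hz.exists_isNKW
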